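/- arXiv:2311.03230 — 2 statements merged into one kernel-verified Lean document; each statement's English description precedes it below -/
import Mathlib

section
/- There exists an absolute constant C such that for every finite metric space (X, dist) with |X| = n ≥ 2 there exists a family 𝓕 of at most C·log n nonempty subsets of X such that for every symmetric monotonic norm ‖·‖_f on ℝ^n, min_{F∈𝓕} ( |F| + ‖x^F‖_f ) ≤ C·(log n)·min_{F⊆X, F≠∅} ( |F| + ‖x^F‖_f ). -/
/-- The vector of absolute values of the coordinates of `x`, sorted in decreasing order. -/
noncomputable def absSortDesc {d : ℕ} (x : Fin d → ℝ) : Fin d → ℝ :=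
  fun k => |x (Tuple.sort (fun i => |x i|) k.rev)|

/-- The ordered norm `‖x‖_(w) = Σ_k w_k (|x|↓)_k`. -/
noncomputable def orderedNorm {d : ℕ} (w x : Fin d → ℝ) : ℝ :=
  ∑ k, w k * absSortDesc x k

/-- The top-`k` norm: the sum of the `k` largest coordinates of `|x|`. -/
noncomputable def topkNorm {d : ℕ} (k : ℕ) (x : Fin d → ℝ) : ℝ :=
  ∑ i ∈ Finset.univ.filter (fun i : Fin d => (i : ℕ) < k), absSortDesc x i

/-- A weight vector: nonincreasing, nonnegative, nonzero. -/
def IsWeightVector {d : ℕ} (w : Fin d → ℝ) : Prop :=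
  Antitone w ∧ (∀ k, 0 ≤ w k) ∧ w ≠ 0

/-- A symmetric monotonic norm on `ι → ℝ`. -/
def IsSymMonotoneNorm {ι : Type*} [Fintype ι] (f : (ι → ℝ) → ℝ) : Prop :=
  (∀ x, f x = 0 ↔ x = 0) ∧
  (∀ (a : ℝ) (x : ι → ℝ), f (a • x) = |a| * f x) ∧
  (∀ x y : ι → ℝ, f (x + y) ≤ f x + f y) ∧
  (∀ (σ : Equiv.Perm ι) (x : ι → ℝ), f (x ∘ σ) = f x) ∧
  (∀ x y : ι → ℝ, (∀ i, 0 ≤ x i) → (∀ i, x i ≤ y i) → f x ≤ f y)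

/-- Feasible load vectors of the Machine-Loads-Identical-Jobs problem. -/
def MLIJ {d : ℕ} (p : Fin d → ℝ) (n : ℕ) : Set (Fin d → ℝ) :=
  { x | ∃ m : Fin d → ℕ, (∑ i, m i) = n ∧ ∀ i, x i = (m i : ℝ) * p i }

/-- The dual of the ordered norm. -/
noncomputable def dualOrderedNorm {d : ℕ} (w y : Fin d → ℝ) : ℝ :=
  sSup { r : ℝ | ∃ x : Fin d → ℝ, orderedNorm w x ≤ 1 ∧ r = ∑ i, y i * x i }

/-- The coordinates of `x` sorted in increasing order. -/
noncomputable def sortAsc {n : ℕ} (x : Fin n → ℝ) : Fin n → ℝ :=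
  fun k => x (Tuple.sort x k)

/-- Distance vector induced by a set of open facilities. -/
noncomputable def distVec {X : Type*} [MetricSpace X] (F : Finset X) : X → ℝ :=
  fun j => sInf ((fun c => dist j c) '' (F : Set X))

/-- `x(l)`: the vector with the first `l+1` coordinates (indices `≤ l`) equal to
`n / Σ_{j ≤ l} 1/p_j` and zero elsewhere. -/
noncomputable def vertexX {d : ℕ} (p : Fin d → ℝ) (n : ℝ) (l : Fin d) : Fin d → ℝ :=
  fun i => if i ≤ l then n / (∑ j ∈ Finset.univ.filter (fun j : Fin d => j ≤ l), 1 / p j) else 0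

/-- Completion time of job `j` when job `j'` is assigned to machine `a j'` and jobs are
processed on each machine in the order induced by the priority permutation `π`. -/
noncomputable def completionTime {n d : ℕ} (p : Fin d → Fin n → ℝ)
    (a : Fin n → Fin d) (π : Equiv.Perm (Fin n)) : Fin n → ℝ :=
  fun j => ∑ j' ∈ Finset.univ.filter (fun j' : Fin n => a j' = a j ∧ π j' ≤ π j), p (a j) j'

/-- A tour on `n` vertices starting at `v₀`: `τ 0 = v₀` and `τ` is a bijection from
`{0, …, n-1}` onto the vertex set. -/
def IsTour {V : Type*} (n : ℕ) (v₀ : V) (τ : ℕ → V) : Prop :=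
  τ 0 = v₀ ∧ Set.BijOn τ (Set.Iio n) Set.univ

/-- The visit times of the vertices `τ 0, …, τ (n-1)` of a tour. -/
noncomputable def tourVisitTimes {V : Type*} [MetricSpace V] (n : ℕ) (τ : ℕ → V) : Fin n → ℝ :=
  fun i => ∑ j ∈ Finset.range (i : ℕ), dist (τ j) (τ (j + 1))

/-- Cover time of element `e` under the ordering `π` of the subsets `S 0, …, S (m-1)`:
the position (in `{1, …, m}`) of the first subset containing `e`. -/
noncomputable def coverTime {n m : ℕ} (S : Fin m → Finset (Fin n))
    (π : Equiv.Perm (Fin m)) (e : Fin n) : ℕ :=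
  1 + sInf {t : ℕ | ∃ h : t < m, e ∈ S (π ⟨t, h⟩)}

theorem distVec_nonneg {X : Type*} [MetricSpace X] (F : Finset X) (j : X) : 0 ≤ distVec F j := by
  refine Real.sInf_nonneg ?_
  rintro _ ⟨c, -, rfl⟩
  exact dist_nonneg

theorem distVec_anti {X : Type*} [MetricSpace X] {F G : Finset X} (hF : F.Nonempty) (h : F ⊆ G)
    (j : X) : distVec G j ≤ distVec F j := by
  refine csInf_le_csInf ⟨0, ?_⟩ (hF.to_set.image _) (Set.image_mono (Finset.coe_subset.2 h))
  rintro _ ⟨c, -, rfl⟩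
  exact dist_nonneg

namespace IsSymMonotoneNorm

variable {ι : Type*} [Fintype ι] {f : (ι → ℝ) → ℝ}

theorem nonneg (hf : IsSymMonotoneNorm f) {x : ι → ℝ} (hx : ∀ i, 0 ≤ x i) : 0 ≤ f x := by
  have h := hf.2.2.2.2 0 x (fun _ => le_rfl) hx
  rwa [(hf.1 0).2 rfl] at h

/-- A vector supported on `s` that is dominated there by an injective rearrangement of `y` has
norm at most that of `y`. -/
theorem le_of_injOn (hf : IsSymMonotoneNorm f) {x y : ι → ℝ} (hx : ∀ i, 0 ≤ x i)
    (hy : ∀ i, 0 ≤ y i) (s : Finset ι) (hs : ∀ i ∉ s, x i = 0) (φ : ι → ι)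
    (hφ : Set.InjOn φ s) (hxy : ∀ i ∈ s, x i ≤ y (φ i)) : f x ≤ f y := by
  classical
  obtain ⟨g, hg⟩ := Finset.exists_equiv_extend_of_card_eq (t := (Finset.univ : Finset ι))
    (Finset.card_univ (α := ι)).symm (Finset.subset_univ _) hφ
  let σ : Equiv.Perm ι := g.trans (Equiv.subtypeUnivEquiv Finset.mem_univ)
  have hσ : ∀ i ∈ s, σ i = φ i := hg
  rw [← hf.2.2.2.1 σ y]
  refine hf.2.2.2.2 _ _ hx fun i => ?_
  by_cases hi : i ∈ s
  · simpa [hσ i hi] using hxy i hi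
  · simpa [hs i hi] using hy (σ i)

/-- If every coordinate of `x` is dominated by a coordinate of `y`, each coordinate of `y` being
used at most once on `s` and at most once off `s`, then `f x ≤ 2 * f y`. -/
theorem le_two_mul (hf : IsSymMonotoneNorm f) {x y : ι → ℝ} (hx : ∀ i, 0 ≤ x i)
    (hy : ∀ i, 0 ≤ y i) (s : Set ι) (φ : ι → ι) (hφ : Set.InjOn φ s) (hφ' : Set.InjOn φ sᶜ)
    (hxy : ∀ i, x i ≤ y (φ i)) : f x ≤ 2 * f y := by
  classical
  have key : ∀ t : Set ι, Set.InjOn φ t → f (t.indicator x) ≤ f y := fun t ht =>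
    hf.le_of_injOn (Set.indicator_nonneg fun i _ => hx i) hy t.toFinset
      (fun i hi => Set.indicator_of_notMem (by simpa using hi) _) φ (by simpa using ht)
      (fun i hi => by
        rw [Set.indicator_of_mem (by simpa using hi)]
        exact hxy i)
  have hsum := hf.2.2.1 (s.indicator x) (sᶜ.indicator x)
  rw [Set.indicator_self_add_compl] at hsum
  linarith [key s hφ, key sᶜ hφ']

end IsSymMonotoneNorm

theorem exists_equiv_antitone {ι : Type*} [Fintype ι] {n : ℕ} (h : Fintype.card ι = n)
    (x : ι → ℝ) : ∃ e : Fin n ≃ ι, Antitone (x ∘ e) := by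
  let e₀ : Fin n ≃ ι := (Fintype.equivFinOfCardEq h).symm
  refine ⟨Fin.revPerm.trans ((Tuple.sort (x ∘ e₀)).trans e₀), fun i j hij => ?_⟩
  exact Tuple.monotone_sort (x ∘ e₀) (Fin.rev_le_rev.2 hij)

/-- Decreasing rearrangement is monotone. -/
theorem sorted_le_sorted {ι : Type*} {n : ℕ} {x y : ι → ℝ} (hxy : ∀ i, x i ≤ y i)
    {e e' : Fin n ≃ ι} (he : Antitone (x ∘ e)) (he' : Antitone (y ∘ e')) (j : Fin n) :
    x (e j) ≤ y (e' j) := by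
  by_contra! hlt
  have hmap : ∀ a ∈ Finset.Iic j, e'.symm (e a) ∈ Finset.Iio j := by
    intro a ha
    rw [Finset.mem_Iio]
    by_contra! hja
    have h₁ : x (e j) ≤ x (e a) := he (Finset.mem_Iic.1 ha)
    have h₂ : y (e' (e'.symm (e a))) ≤ y (e' j) := he' hja
    rw [Equiv.apply_symm_apply] at h₂
    linarith [hxy (e a)]
  have hcard := Finset.card_le_card_of_injOn (fun a => e'.symm (e a)) hmap
    (e.trans e'.symm).injective.injOn
  rw [Fin.card_Iic, Fin.card_Iio] at hcard
  omega

/-- A set of `O(k log n)` facilities whose distance vector is simultaneously within a factor `2`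
of that of every set of at most `k` facilities, for every symmetric monotonic norm. -/
theorem exists_simultaneous_facilities {X : Type*} [MetricSpace X] [Fintype X] {n : ℕ}
    (hn : 0 < n) (hX : Fintype.card X = n) {k : ℕ} (hk : 0 < k) :
    ∃ G : Finset X, G.Nonempty ∧ G.card ≤ (Nat.log 2 n + 1) * k ∧
      ∀ f : (X → ℝ) → ℝ, IsSymMonotoneNorm f → ∀ F : Finset X, F.Nonempty → F.card ≤ k →
        f (distVec G) ≤ 2 * f (distVec F) := by
  classical
  choose e he using fun F : Finset X => exists_equiv_antitone hX (distVec F)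
  obtain ⟨x₀⟩ : Nonempty X := Fintype.card_pos_iff.1 (hX ▸ hn)
  have hopt : ∀ z : Fin n, ∃ H : Finset X, (H.Nonempty ∧ H.card ≤ k) ∧
      ∀ F : Finset X, F.Nonempty → F.card ≤ k →
        distVec H (e H z) ≤ distVec F (e F z) := by
    intro z
    obtain ⟨H, hH, hmin⟩ := (Finset.univ.filter
      fun F : Finset X => F.Nonempty ∧ F.card ≤ k).exists_min_image
        (fun F => distVec F (e F z)) ⟨{x₀}, by simpa using Nat.succ_le_of_lt hk⟩
    refine ⟨H, by simpa using hH, fun F h₁ h₂ => hmin F (by simp [h₁, h₂])⟩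
  choose H hH hmin using hopt
  have hidx : ∀ i : ℕ, (2 ^ i - 1) % n < n := fun i => Nat.mod_lt _ hn
  let K : ℕ → Finset X := fun i => H ⟨(2 ^ i - 1) % n, hidx i⟩
  let G : Finset X := (Finset.range (Nat.log 2 n + 1)).biUnion K
  have hKG : ∀ i ≤ Nat.log 2 n, K i ⊆ G := fun i hi =>
    Finset.subset_biUnion_of_mem K (Finset.mem_range.2 (Nat.lt_succ_of_le hi))
  refine ⟨G, (hH _).1.mono (hKG 0 (Nat.zero_le _)), ?_, ?_⟩
  · simpa using Finset.card_biUnion_le_card_mul (Finset.range (Nat.log 2 n + 1)) K k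
      (fun i _ => (hH _).2)
  intro f hf F hF hFk
  let half : Fin n → Fin n := fun j => ⟨j / 2, (Nat.div_le_self _ _).trans_lt j.2⟩
  have hdom : ∀ j : Fin n, distVec G (e G j) ≤ distVec F (e F (half j)) := by
    intro j
    set i := Nat.log 2 (j + 1) with hi
    have hle : 2 ^ i ≤ (j : ℕ) + 1 := Nat.pow_log_le_self 2 (by omega)
    have hlt : (j : ℕ) + 1 < 2 ^ i * 2 := by
      rw [← pow_succ]
      exact Nat.lt_pow_succ_log_self (by norm_num) _
    have hin : i ≤ Nat.log 2 n := Nat.log_mono_right (by omega)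
    have hmod : (2 ^ i - 1) % n = 2 ^ i - 1 := Nat.mod_eq_of_lt (by omega)
    let z : Fin n := ⟨(2 ^ i - 1) % n, hidx i⟩
    have hzj : z ≤ j := by
      rw [Fin.le_def]
      change (2 ^ i - 1) % n ≤ _
      omega
    have hjz : half j ≤ z := by
      rw [Fin.le_def]
      change (j : ℕ) / 2 ≤ (2 ^ i - 1) % n
      omega
    calc distVec G (e G j) ≤ distVec G (e G z) := he G hzj
      _ ≤ distVec (H z) (e (H z) z) :=
        sorted_le_sorted (distVec_anti (hH z).1 (hKG i hin)) (he G) (he (H z)) z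
      _ ≤ distVec F (e F z) := hmin z F hF hFk
      _ ≤ distVec F (e F (half j)) := he F hjz
  have hinj : ∀ a b : X, ((e G).symm a : ℕ) % 2 = ((e G).symm b : ℕ) % 2 →
      e F (half ((e G).symm a)) = e F (half ((e G).symm b)) → a = b := by
    intro a b hab h
    have hdiv : ((e G).symm a : ℕ) / 2 = ((e G).symm b : ℕ) / 2 :=
      congrArg Fin.val ((e F).injective h)
    exact (e G).symm.injective (Fin.ext (by omega))
  refine hf.le_two_mul (distVec_nonneg G) (distVec_nonneg F)
    {a | ((e G).symm a : ℕ) % 2 = 0} (fun a => e F (half ((e G).symm a))) ?_ ?_ ?_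
  · intro a ha b hb h
    exact hinj a b (ha.trans hb.symm) h
  · intro a ha b hb h
    have ha' : ¬ ((e G).symm a : ℕ) % 2 = 0 := ha
    have hb' : ¬ ((e G).symm b : ℕ) % 2 = 0 := hb
    exact hinj a b (by omega) h
  · intro a
    simpa using hdom ((e G).symm a)

theorem natLog_two_add_one_le {n : ℕ} (hn : 2 ≤ n) :
    ((Nat.log 2 n + 1 : ℕ) : ℝ) ≤ 4 * Real.log n := by
  have hL : 1 ≤ Nat.log 2 n := Nat.log_pos (by norm_num) hn
  have hL' : (1 : ℝ) ≤ Nat.log 2 n := by exact_mod_cast hL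
  have hpow : (2 : ℝ) ^ Nat.log 2 n ≤ n := by
    exact_mod_cast Nat.pow_log_le_self 2 (by omega : n ≠ 0)
  have hlog := Real.log_le_log (by positivity) hpow
  rw [Real.log_pow] at hlog
  push_cast
  nlinarith [Real.log_two_gt_d9]

/-- Theorem: O(log n)-size, O(log n)-approximate portfolio for
Uncapacitated-Facility-Location over symmetric monotonic norms. -/
theorem stmt9 :
    ∃ C : ℝ, 0 < C ∧
      ∀ (X : Type) [MetricSpace X] [Fintype X],
        ∀ n : ℕ, 2 ≤ n → Fintype.card X = n →
          ∃ FF : Finset (Finset X), (∀ F ∈ FF, F.Nonempty) ∧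
            (FF.card : ℝ) ≤ C * Real.log n ∧
            ∀ f : (X → ℝ) → ℝ, IsSymMonotoneNorm f →
              ∀ F' : Finset X, F'.Nonempty →
                ∃ F ∈ FF, (F.card : ℝ) + f (distVec F) ≤
                  C * Real.log n * ((F'.card : ℝ) + f (distVec F')) := by
  refine ⟨8, by norm_num, fun X _ _ n hn hX => ?_⟩
  classical
  have hlog := natLog_two_add_one_le hn
  choose G hGne hGcard hG using fun i : ℕ =>
    exists_simultaneous_facilities (by omega : 0 < n) hX (Nat.two_pow_pos (i + 1))
  refine ⟨(Finset.range (Nat.log 2 n + 1)).image G, ?_, ?_, ?_⟩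
  · simp only [Finset.mem_image]
    rintro _ ⟨i, -, rfl⟩
    exact hGne i
  · have hcard : ((Finset.range (Nat.log 2 n + 1)).image G).card ≤ Nat.log 2 n + 1 := by
      simpa using Finset.card_image_le (s := Finset.range (Nat.log 2 n + 1)) (f := G)
    have hcard' : (((Finset.range (Nat.log 2 n + 1)).image G).card : ℝ) ≤
        ((Nat.log 2 n + 1 : ℕ) : ℝ) := by exact_mod_cast hcard
    have hpos : (0 : ℝ) ≤ ((Nat.log 2 n + 1 : ℕ) : ℝ) := Nat.cast_nonneg _
    linarith
  · intro f hf F hF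
    set i := Nat.log 2 F.card with hi
    have hle : 2 ^ i ≤ F.card := Nat.pow_log_le_self 2 hF.card_pos.ne'
    have hlt : F.card < 2 ^ (i + 1) := Nat.lt_pow_succ_log_self (by norm_num) _
    have hin : i ≤ Nat.log 2 n := Nat.log_mono_right (hX ▸ F.card_le_univ)
    refine ⟨G i, Finset.mem_image_of_mem G (Finset.mem_range.2 (Nat.lt_succ_of_le hin)), ?_⟩
    have hnorm := hG i f hf F hF hlt.le
    have hcard : (G i).card ≤ (Nat.log 2 n + 1) * (2 * F.card) :=
      (hGcard i).trans (Nat.mul_le_mul_left _ (by rw [pow_succ]; omega))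
    have hcard' : ((G i).card : ℝ) ≤ ((Nat.log 2 n + 1 : ℕ) : ℝ) * (2 * (F.card : ℝ)) := by
      exact_mod_cast hcard
    have hone : (1 : ℝ) ≤ ((Nat.log 2 n + 1 : ℕ) : ℝ) := by
      exact_mod_cast Nat.le_add_left 1 _
    have hfpos : 0 ≤ f (distVec F) := hf.nonneg (distVec_nonneg F)
    have hFpos : (0 : ℝ) ≤ F.card := Nat.cast_nonneg _
    calc ((G i).card : ℝ) + f (distVec (G i))
        ≤ 2 * ((Nat.log 2 n + 1 : ℕ) : ℝ) * ((F.card : ℝ) + f (distVec F)) := by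
          nlinarith [mul_le_mul_of_nonneg_right hone hfpos]
      _ ≤ 8 * Real.log n * ((F.card : ℝ) + f (distVec F)) :=
          mul_le_mul_of_nonneg_right (by linarith) (by linarith)
end

section
/- Let w ∈ ℝ^d be a weight vector and let x, y ∈ ℝ_{≥0}^d. Then ‖x‖_(w) · ‖y‖*_(w) ≥ xᵀy. Moreover, equality holds if and only if both of the following hold: (1) there exists a permutation π of {1,…,d} such that x_{π(1)} ≥ x_{π(2)} ≥ … ≥ x_{π(d)} and y_{π(1)} ≥ y_{π(2)} ≥ … ≥ y_{π(d)}; and (2) for each k ∈ {1,…,d}, either x↓_k = x↓_{k+1} (with the convention x↓_{d+1} = 0) or ‖y‖_{(k)} / ‖w‖_{(k)} = ‖y‖*_(w), where x↓ denotes x sorted in decreasing order. -/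
theorem antitone_absSortDesc {d : ℕ} (x : Fin d → ℝ) : Antitone (absSortDesc x) :=
  fun _ _ hij => Tuple.monotone_sort (fun i => |x i|) (Fin.rev_le_rev.2 hij)

theorem absSortDesc_nonneg {d : ℕ} (x : Fin d → ℝ) (k : Fin d) : 0 ≤ absSortDesc x k :=
  abs_nonneg _

theorem exists_perm_absSortDesc_eq {d : ℕ} (x : Fin d → ℝ) :
    ∃ τ : Equiv.Perm (Fin d), ∀ k, absSortDesc x k = |x (τ k)| :=
  ⟨Fin.revPerm.trans (Tuple.sort fun i => |x i|), fun _ => rfl⟩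

theorem absSortDesc_eq_of_antitone {d : ℕ} {x : Fin d → ℝ} (σ : Equiv.Perm (Fin d))
    (h : Antitone fun i => |x (σ i)|) (k : Fin d) : absSortDesc x k = |x (σ k)| := by
  obtain ⟨τ, hτ⟩ := exists_perm_absSortDesc_eq x
  have hτ' : Antitone ((fun i => |x i|) ∘ τ) := by
    have := antitone_absSortDesc x
    rwa [funext hτ] at this
  exact (hτ k).trans (congrFun (Tuple.unique_antitone (f := fun i => |x i|) hτ' h) k)

theorem abs_le_absSortDesc_zero {d : ℕ} (x : Fin d → ℝ) (hd : 0 < d) (i : Fin d) :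
    |x i| ≤ absSortDesc x ⟨0, hd⟩ := by
  obtain ⟨τ, hτ⟩ := exists_perm_absSortDesc_eq x
  calc |x i| = absSortDesc x (τ.symm i) := by rw [hτ, Equiv.apply_symm_apply]
    _ ≤ absSortDesc x ⟨0, hd⟩ := antitone_absSortDesc x (Nat.zero_le _)

theorem IsWeightVector.absSortDesc_eq {d : ℕ} {w : Fin d → ℝ} (hw : IsWeightVector w) :
    absSortDesc w = w := by
  funext k
  have h := absSortDesc_eq_of_antitone (x := w) (Equiv.refl _)
    (by simpa only [Equiv.refl_apply, abs_of_nonneg (hw.2.1 _)] using hw.1) k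
  rwa [Equiv.refl_apply, abs_of_nonneg (hw.2.1 k)] at h

theorem IsWeightVector.dim_pos {d : ℕ} {w : Fin d → ℝ} (hw : IsWeightVector w) : 0 < d := by
  obtain ⟨i, -⟩ := Function.ne_iff.1 hw.2.2
  exact i.pos

theorem IsWeightVector.zero_pos {d : ℕ} {w : Fin d → ℝ} (hw : IsWeightVector w) :
    0 < w ⟨0, hw.dim_pos⟩ := by
  obtain ⟨i, hi⟩ := Function.ne_iff.1 hw.2.2
  exact ((hw.2.1 i).lt_of_ne' hi).trans_le (hw.1 (Nat.zero_le _))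

theorem IsWeightVector.topkNorm_pos {d : ℕ} {w : Fin d → ℝ} (hw : IsWeightVector w) (k : ℕ) :
    0 < topkNorm (k + 1) w := by
  unfold topkNorm
  rw [hw.absSortDesc_eq]
  exact Finset.sum_pos' (fun i _ => hw.2.1 i) ⟨⟨0, hw.dim_pos⟩, by simp, hw.zero_pos⟩

theorem bddAbove_dot_of_orderedNorm_le_one {d : ℕ} {w : Fin d → ℝ} (hw : IsWeightVector w)
    (y : Fin d → ℝ) :
    BddAbove { r : ℝ | ∃ x : Fin d → ℝ, orderedNorm w x ≤ 1 ∧ r = ∑ i, y i * x i } := by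
  refine ⟨∑ i, |y i| * (1 / w ⟨0, hw.dim_pos⟩), ?_⟩
  rintro _ ⟨x, hx, rfl⟩
  refine Finset.sum_le_sum fun i _ => ?_
  have h0 : w ⟨0, hw.dim_pos⟩ * absSortDesc x ⟨0, hw.dim_pos⟩ ≤ orderedNorm w x :=
    Finset.single_le_sum (f := fun k => w k * absSortDesc x k)
      (fun k _ => mul_nonneg (hw.2.1 k) (absSortDesc_nonneg x k)) (Finset.mem_univ _)
  have hxi : |x i| ≤ 1 / w ⟨0, hw.dim_pos⟩ := by
    rw [le_div_iff₀' hw.zero_pos]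
    exact (mul_le_mul_of_nonneg_left (abs_le_absSortDesc_zero x hw.dim_pos i)
      hw.zero_pos.le).trans (h0.trans hx)
  calc y i * x i ≤ |y i| * |x i| := (le_abs_self _).trans_eq (abs_mul _ _)
    _ ≤ _ := mul_le_mul_of_nonneg_left hxi (abs_nonneg _)

theorem topkNorm_le_dualOrderedNorm_mul {d : ℕ} {w y : Fin d → ℝ} (hw : IsWeightVector w)
    (hy : ∀ i, 0 ≤ y i) (k : ℕ) :
    topkNorm (k + 1) y ≤ dualOrderedNorm w y * topkNorm (k + 1) w := by
  have hW := hw.topkNorm_pos k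
  obtain ⟨τ, hτ⟩ := exists_perm_absSortDesc_eq y
  set c := (topkNorm (k + 1) w)⁻¹ with hc
  have hc0 : 0 ≤ c := (inv_pos.2 hW).le
  let u : Fin d → ℝ := fun i => if (τ.symm i : ℕ) < k + 1 then c else 0
  have huτ (i : Fin d) : u (τ i) = if (i : ℕ) < k + 1 then c else 0 := by simp [u]
  have hua (i : Fin d) : |u (τ i)| = if (i : ℕ) < k + 1 then c else 0 := by
    rw [huτ, abs_of_nonneg]
    split_ifs <;> simp [hc0]
  have husort := absSortDesc_eq_of_antitone (x := u) τ (fun i j hij => by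
    have : (i : ℕ) ≤ j := hij
    simp only [hua]
    split_ifs <;> first | omega | simp)
  have hnorm : orderedNorm w u = 1 := by
    simp only [orderedNorm, husort, hua, mul_ite, mul_zero]
    rw [← Finset.sum_filter, ← Finset.sum_mul, hc]
    refine (congrArg (· * (topkNorm (k + 1) w)⁻¹) ?_).trans (mul_inv_cancel₀ hW.ne')
    rw [topkNorm, hw.absSortDesc_eq]
  have hdot : ∑ i, y i * u i = topkNorm (k + 1) y * c := by
    rw [← Equiv.sum_comp τ]
    simp only [huτ, mul_ite, mul_zero]
    rw [← Finset.sum_filter, ← Finset.sum_mul, topkNorm]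
    simp only [hτ, abs_of_nonneg (hy _)]
  rw [← div_le_iff₀ hW, div_eq_mul_inv, ← hc, ← hdot]
  exact le_csSup (bddAbove_dot_of_orderedNorm_le_one hw y) ⟨u, hnorm.le, rfl⟩

theorem sum_range_mul_eq_sum_sub_mul_sum (a b : ℕ → ℝ) (n : ℕ) :
    ∑ i ∈ Finset.range n, a i * b i =
      ∑ i ∈ Finset.range n, (a i - a (i + 1)) * ∑ j ∈ Finset.range (i + 1), b j +
        a n * ∑ j ∈ Finset.range n, b j := by
  induction n with
  | zero => simp
  | succ n ih =>
    rw [Finset.sum_range_succ, ih, Finset.sum_range_succ _ n, Finset.sum_range_succ b n]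
    ring

/-- Summation by parts on `Fin d`, with the convention that `a` vanishes past its last entry. -/
theorem sum_mul_eq_sum_sub_mul_sum_filter {d : ℕ} (a b : Fin d → ℝ) :
    ∑ k, a k * b k =
      ∑ k : Fin d, (a k - if h : (k : ℕ) + 1 < d then a ⟨(k : ℕ) + 1, h⟩ else 0) *
        ∑ i ∈ Finset.univ.filter (fun i : Fin d => (i : ℕ) < (k : ℕ) + 1), b i := by
  let a' : ℕ → ℝ := fun n => if h : n < d then a ⟨n, h⟩ else 0
  let b' : ℕ → ℝ := fun n => if h : n < d then b ⟨n, h⟩ else 0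
  have h := sum_range_mul_eq_sum_sub_mul_sum a' b' d
  have had : a' d = 0 := by simp [a']
  rw [had, zero_mul, add_zero, Finset.sum_range, Finset.sum_range] at h
  have ha (k : Fin d) : a' k = a k := by simp [a']
  have hb (k : Fin d) : b' k = b k := by simp [b']
  simp only [ha, hb] at h
  rw [h]
  refine Finset.sum_congr rfl fun k _ => congrArg (HMul.hMul _) ?_
  refine (Finset.sum_bij (fun (i : Fin d) _ => (i : ℕ)) ?_ ?_ ?_ ?_).symm
  · intro i hi
    simpa using hi
  · intro i _ j _ hij
    exact Fin.ext hij
  · intro j hj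
    have hj' := Finset.mem_range.1 hj
    exact ⟨⟨j, by omega⟩, by simpa only [Finset.mem_filter_univ] using hj', rfl⟩
  · intro i _
    exact (hb i).symm

theorem monovary_iff_exists_perm_antitone {d : ℕ} {x y : Fin d → ℝ} :
    Monovary x y ↔ ∃ π : Equiv.Perm (Fin d),
      Antitone (fun i => x (π i)) ∧ Antitone (fun i => y (π i)) := by
  constructor
  · intro h
    have hsort : Monotone fun i => -(x + y) (Tuple.sort (-(x + y)) i) :=
      Tuple.monotone_sort (-(x + y))
    refine ⟨Tuple.sort (-(x + y)), fun i j hij => ?_, fun i j hij => ?_⟩ <;>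
    · have hs := hsort hij
      simp only [Pi.add_apply] at hs
      by_contra! hlt
      first
      | linarith [h hlt]
      | linarith [h.symm hlt]
  · rintro ⟨π, hx, hy⟩
    simpa [Function.comp_def] using (hx.monovary hy).comp_right π.symm

theorem sum_mul_le_sum_absSortDesc_mul {d : ℕ} {x y : Fin d → ℝ} (hx : ∀ i, 0 ≤ x i)
    (hy : ∀ i, 0 ≤ y i) :
    ∑ i, x i * y i ≤ ∑ i, absSortDesc x i * absSortDesc y i ∧
      (∑ i, x i * y i = ∑ i, absSortDesc x i * absSortDesc y i ↔ Monovary x y) := by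
  obtain ⟨τ, hτ⟩ := exists_perm_absSortDesc_eq x
  obtain ⟨σ, hσ⟩ := exists_perm_absSortDesc_eq y
  have hX : absSortDesc x = x ∘ τ := funext fun k => by rw [hτ, abs_of_nonneg (hx _)]; rfl
  have hY : absSortDesc y = y ∘ σ := funext fun k => by rw [hσ, abs_of_nonneg (hy _)]; rfl
  have hXY := (antitone_absSortDesc x).monovary (antitone_absSortDesc y)
  have hdot : ∑ i, x i * y i = ∑ i, absSortDesc x i * absSortDesc y ((τ.trans σ.symm) i) := by
    rw [← Equiv.sum_comp τ]
    simp [hX, hY]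
  have hcomp : absSortDesc y ∘ (τ.trans σ.symm) = y ∘ τ := by
    funext i
    simp [hY]
  rw [hdot]
  refine ⟨hXY.sum_mul_comp_perm_le_sum_mul, hXY.sum_mul_comp_perm_eq_sum_mul_iff.trans ?_⟩
  rw [hcomp, hX]
  refine ⟨fun h => ?_, fun h => h.comp_right τ⟩
  simpa [Function.comp_def] using h.comp_right τ.symm

theorem sum_absSortDesc_mul_le {d : ℕ} {w x y : Fin d → ℝ} (hw : IsWeightVector w)
    (hy : ∀ i, 0 ≤ y i) :
    ∑ i, absSortDesc x i * absSortDesc y i ≤ orderedNorm w x * dualOrderedNorm w y ∧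
      (∑ i, absSortDesc x i * absSortDesc y i = orderedNorm w x * dualOrderedNorm w y ↔
        ∀ k : Fin d,
          absSortDesc x k =
              (if h : (k : ℕ) + 1 < d then absSortDesc x ⟨(k : ℕ) + 1, h⟩ else 0) ∨
            topkNorm ((k : ℕ) + 1) y / topkNorm ((k : ℕ) + 1) w = dualOrderedNorm w y) := by
  have hdrop (k : Fin d) : 0 ≤ absSortDesc x k -
      if h : (k : ℕ) + 1 < d then absSortDesc x ⟨(k : ℕ) + 1, h⟩ else 0 := by
    split_ifs with h
    · exact sub_nonneg.2 (antitone_absSortDesc x (Nat.le_succ _))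
    · simpa using absSortDesc_nonneg x k
  have hnorm : orderedNorm w x * dualOrderedNorm w y =
      ∑ k : Fin d, (absSortDesc x k -
        if h : (k : ℕ) + 1 < d then absSortDesc x ⟨(k : ℕ) + 1, h⟩ else 0) *
          (dualOrderedNorm w y * topkNorm ((k : ℕ) + 1) w) := by
    simp only [orderedNorm, topkNorm, hw.absSortDesc_eq, mul_comm (w _)]
    rw [sum_mul_eq_sum_sub_mul_sum_filter, Finset.sum_mul]
    exact Finset.sum_congr rfl fun k _ => by ring
  have hle : ∀ k ∈ Finset.univ, (absSortDesc x k -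
      if h : (k : ℕ) + 1 < d then absSortDesc x ⟨(k : ℕ) + 1, h⟩ else 0) *
        topkNorm ((k : ℕ) + 1) y ≤ (absSortDesc x k -
      if h : (k : ℕ) + 1 < d then absSortDesc x ⟨(k : ℕ) + 1, h⟩ else 0) *
        (dualOrderedNorm w y * topkNorm ((k : ℕ) + 1) w) := fun k _ =>
    mul_le_mul_of_nonneg_left (topkNorm_le_dualOrderedNorm_mul hw hy k) (hdrop k)
  rw [hnorm, sum_mul_eq_sum_sub_mul_sum_filter]
  refine ⟨Finset.sum_le_sum hle, (Finset.sum_eq_sum_iff_of_le hle).trans ?_⟩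
  refine ⟨fun h k => ?_, fun h k _ => ?_⟩
  · rw [div_eq_iff (hw.topkNorm_pos k).ne', ← sub_eq_zero, or_comm]
    exact mul_eq_mul_left_iff.1 (h k (Finset.mem_univ k))
  · specialize h k
    rw [div_eq_iff (hw.topkNorm_pos k).ne', ← sub_eq_zero, or_comm] at h
    exact mul_eq_mul_left_iff.2 h

/-- Lemma (ordered Cauchy–Schwarz, with equality conditions). -/
theorem stmt12 {d : ℕ} (w : Fin d → ℝ) (hw : IsWeightVector w)
    (x y : Fin d → ℝ) (hx : ∀ i, 0 ≤ x i) (hy : ∀ i, 0 ≤ y i) :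
    (∑ i, x i * y i) ≤ orderedNorm w x * dualOrderedNorm w y ∧
    ((∑ i, x i * y i) = orderedNorm w x * dualOrderedNorm w y ↔
      ((∃ π : Equiv.Perm (Fin d),
          Antitone (fun i => x (π i)) ∧ Antitone (fun i => y (π i))) ∧
        ∀ k : Fin d,
          absSortDesc x k =
              (if h : (k : ℕ) + 1 < d then absSortDesc x ⟨(k : ℕ) + 1, h⟩ else 0) ∨
            topkNorm ((k : ℕ) + 1) y / topkNorm ((k : ℕ) + 1) w = dualOrderedNorm w y)) := by
  obtain ⟨hle₁, heq₁⟩ := sum_mul_le_sum_absSortDesc_mul hx hy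
  obtain ⟨hle₂, heq₂⟩ := sum_absSortDesc_mul_le (x := x) hw hy
  refine ⟨hle₁.trans hle₂, ?_⟩
  rw [← monovary_iff_exists_perm_antitone, ← heq₁, ← heq₂]
  exact ⟨fun h => ⟨hle₁.antisymm (hle₂.trans_eq h.symm), hle₂.antisymm (h.symm.trans_le hle₁)⟩,
    fun h => h.1.trans h.2⟩
end
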